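/- Let σ ⊂ 𝔻 be a finite set and p, q ≥ 1 with p/q a positive integer. Then c(σ, H^p, H^∞) ≥ c(σ, H^q, H^∞)^{q/p}. -/

import Mathlib

open Complex Metric

noncomputable def blaschke16 (l z : ℂ) : ℂ := (l - z) / (1 - (starRingEnd ℂ) l * z)

noncomputable def finBlaschke16 (n : ℕ) (l : Fin n → ℂ) (z : ℂ) : ℂ :=
  ∏ j, blaschke16 (l j) z

/-- The interpolation constant `c(σ, H^p, H^∞)`: sup over the unit ball of
`H^p` of the least sup-norm of a bounded holomorphic `g` agreeing with `f`
on `σ` with multiplicities (i.e. `g - f ∈ B_σ Hol(𝔻)`). -/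
noncomputable def cHp16 (p : ℝ) (n : ℕ) (l : Fin n → ℂ) : ℝ :=
  sSup {t : ℝ | ∃ f : ℂ → ℂ, DifferentiableOn ℂ f (ball (0:ℂ) 1) ∧
    (∀ ρ : ℝ, 0 ≤ ρ → ρ < 1 →
      (1 / (2 * Real.pi)) *
          ∫ θ in (0:ℝ)..(2 * Real.pi),
            ‖f ((ρ : ℂ) * Complex.exp (θ * Complex.I))‖ ^ p ≤ 1) ∧
    t = sInf {C : ℝ | 0 ≤ C ∧ ∃ g u : ℂ → ℂ,
      DifferentiableOn ℂ g (ball (0:ℂ) 1) ∧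
      (∀ z ∈ ball (0:ℂ) 1, ‖g z‖ ≤ C) ∧
      DifferentiableOn ℂ u (ball (0:ℂ) 1) ∧
      ∀ z ∈ ball (0:ℂ) 1, g z - f z = finBlaschke16 n l z * u z}}


/-- admissible constants -/
def Adm16 (n : ℕ) (l : Fin n → ℂ) (f : ℂ → ℂ) (C : ℝ) : Prop :=
  0 ≤ C ∧ ∃ g u : ℂ → ℂ,
      DifferentiableOn ℂ g (ball (0:ℂ) 1) ∧
      (∀ z ∈ ball (0:ℂ) 1, ‖g z‖ ≤ C) ∧
      DifferentiableOn ℂ u (ball (0:ℂ) 1) ∧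
      ∀ z ∈ ball (0:ℂ) 1, g z - f z = finBlaschke16 n l z * u z

lemma den_ne16 {a z : ℂ} (ha : ‖a‖ ≤ 1) (hz : ‖z‖ < 1) : 1 - (starRingEnd ℂ) a * z ≠ 0 := by
  intro h
  have h1 : (starRingEnd ℂ) a * z = 1 := (sub_eq_zero.mp h).symm
  have h2 : ‖a‖ * ‖z‖ = 1 := by
    rw [← RCLike.norm_conj a, ← norm_mul]
    simpa using congrArg norm h1
  nlinarith [norm_nonneg a, norm_nonneg z]

lemma norm_le_den16 {a z : ℂ} (ha : ‖a‖ ≤ 1) (hz : ‖z‖ ≤ 1) :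
    ‖z - a‖ ≤ ‖1 - (starRingEnd ℂ) a * z‖ := by
  have h : ‖1 - (starRingEnd ℂ) a * z‖ ^ 2 - ‖z - a‖ ^ 2 = (1 - ‖a‖ ^ 2) * (1 - ‖z‖ ^ 2) := by
    simp only [← Complex.normSq_eq_norm_sq, Complex.normSq_apply]
    simp
    ring
  have h2 : 0 ≤ (1 - ‖a‖ ^ 2) * (1 - ‖z‖ ^ 2) :=
    mul_nonneg (by nlinarith [norm_nonneg a]) (by nlinarith [norm_nonneg z])
  exact le_of_sq_le_sq (by linarith) (norm_nonneg _)

lemma norm_eq_den16 {a z : ℂ} (hz : ‖z‖ = 1) :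
    ‖z - a‖ = ‖1 - (starRingEnd ℂ) a * z‖ := by
  have h : ‖1 - (starRingEnd ℂ) a * z‖ ^ 2 - ‖z - a‖ ^ 2 = (1 - ‖a‖ ^ 2) * (1 - ‖z‖ ^ 2) := by
    simp only [← Complex.normSq_eq_norm_sq, Complex.normSq_apply]
    simp
    ring
  rw [hz] at h
  have : ‖z - a‖ ^ 2 = ‖1 - (starRingEnd ℂ) a * z‖ ^ 2 := by linarith
  exact (pow_left_inj₀ (norm_nonneg _) (norm_nonneg _) two_ne_zero).mp this

lemma blaschke_norm16 {a z : ℂ} (ha : ‖a‖ ≤ 1) (hz : ‖z‖ < 1) : ‖blaschke16 a z‖ ≤ 1 := by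
  unfold blaschke16
  rw [norm_div, norm_sub_rev]
  exact div_le_one_of_le₀ (norm_le_den16 ha hz.le) (norm_nonneg _)

lemma blaschke_diff16 {a : ℂ} (ha : ‖a‖ ≤ 1) :
    DifferentiableOn ℂ (blaschke16 a) (ball (0:ℂ) 1) := by
  unfold blaschke16
  apply DifferentiableOn.div (by fun_prop) (by fun_prop)
  intro z hz
  exact den_ne16 ha (by simpa using hz)

lemma interp16 (n : ℕ) : ∀ (l : Fin n → ℂ) (r : ℝ), r < 1 → (∀ j, ‖l j‖ < r) →
    ∃ K : ℝ, 0 ≤ K ∧ ∀ (f : ℂ → ℂ) (C : ℝ), DifferentiableOn ℂ f (ball (0:ℂ) 1) → 0 ≤ C →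
      (∀ z ∈ closedBall (0:ℂ) r, ‖f z‖ ≤ C) → Adm16 n l f (K * C) := by
  induction n with
  | zero =>
    intro l r hr hl
    refine ⟨0, le_rfl, fun f C hf hC hb => ⟨by simp, 0, -f, by fun_prop, by simp, hf.neg, ?_⟩⟩
    intro z hz
    simp [finBlaschke16]
  | succ n ih =>
    intro l r hr hl
    obtain ⟨K, hK, h⟩ := ih (fun j => l j.succ) r hr (fun j => hl _)
    set a := l 0 with ha
    have har : ‖a‖ < r := hl 0
    have ha1 : ‖a‖ ≤ 1 := by linarith
    have hd : 0 < r - ‖a‖ := by linarith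
    refine ⟨1 + K * (4 / (r - ‖a‖)), by positivity, fun f C hf hC hb => ?_⟩
    set f1 : ℂ → ℂ := fun z => dslope f a z * (-(1 - (starRingEnd ℂ) a * z)) with hf1
    have hnh : ball (0:ℂ) 1 ∈ nhds a := isOpen_ball.mem_nhds (by simp; linarith)
    have hf1d : DifferentiableOn ℂ f1 (ball (0:ℂ) 1) := by
      apply DifferentiableOn.mul
      · exact (Complex.differentiableOn_dslope hnh).mpr hf
      · fun_prop
    have heq : ∀ z ∈ ball (0:ℂ) 1, f z - f a = blaschke16 a z * f1 z := by
      intro z hz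
      have h1 : (z - a) * dslope f a z = f z - f a := by
        simpa using sub_smul_dslope f a z
      have h2 := den_ne16 ha1 (z := z) (by simpa using hz)
      rw [← h1, hf1, blaschke16, div_mul_eq_mul_div, eq_div_iff h2]
      ring
    have hr0 : 0 < r := lt_of_le_of_lt (norm_nonneg _) har
    have hb1 : ∀ z ∈ closedBall (0:ℂ) r, ‖f1 z‖ ≤ 4 / (r - ‖a‖) * C := by
      intro z hz
      apply Complex.norm_le_of_forall_mem_frontier_norm_le (U := ball (0:ℂ) r) isBounded_ball
      · apply DifferentiableOn.diffContOnCl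
        apply hf1d.mono
        rw [closure_ball _ hr0.ne']
        exact closedBall_subset_ball hr
      · intro w hw
        rw [frontier_ball _ hr0.ne', mem_sphere_zero_iff_norm] at hw
        have h1 : (w - a) * dslope f a w = f w - f a := by
          simpa using sub_smul_dslope f a w
        have h2 : r - ‖a‖ ≤ ‖w - a‖ := by
          rw [← hw]; exact norm_sub_norm_le _ _
        have h3 : ‖w - a‖ * ‖dslope f a w‖ ≤ 2 * C := by
          rw [← norm_mul, h1]
          refine (norm_sub_le _ _).trans ?_
          have := hb w (by simp [hw])
          have := hb a (by simp [har.le])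
          linarith
        have h4 : ‖1 - (starRingEnd ℂ) a * w‖ ≤ 2 := by
          refine (norm_sub_le _ _).trans ?_
          rw [norm_mul, RCLike.norm_conj, norm_one]
          nlinarith [norm_nonneg a]
        have h5 : ‖dslope f a w‖ ≤ 2 * C / (r - ‖a‖) := by
          rw [le_div_iff₀ hd]
          nlinarith [norm_nonneg (dslope f a w)]
        simp only [hf1, norm_mul, norm_neg]
        calc _ ≤ 2 * C / (r - ‖a‖) * 2 := by gcongr
          _ = _ := by ring
      · rwa [closure_ball _ hr0.ne']
    obtain ⟨-, g, u, hg, hgb, hu, hgu⟩ := h f1 _ hf1d (by positivity) hb1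
    refine ⟨by positivity, fun z => f a + blaschke16 a z * g z, u, ?_, ?_, hu, ?_⟩
    · exact ((blaschke_diff16 ha1).mul hg).const_add _
    · intro z hz
      refine (norm_add_le _ _).trans ?_
      have e1 := hb a (by simp [har.le])
      have e2 := blaschke_norm16 ha1 (z := z) (by simpa using hz)
      have e3 := hgb z hz
      rw [norm_mul]
      nlinarith [norm_nonneg (g z), norm_nonneg (blaschke16 a z)]
    · intro z hz
      have e1 := heq z hz
      have e2 := hgu z hz
      have e3 : finBlaschke16 (n+1) l z = blaschke16 a z * finBlaschke16 n (fun j => l j.succ) z := by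
        simp [finBlaschke16, Fin.prod_univ_succ, ha]
      rw [e3, mul_assoc, ← e2]
      linear_combination -e1

lemma cont_circ16 {f : ℂ → ℂ} (hf : ContinuousOn f (ball (0:ℂ) 1)) {z : ℂ} (hz : ‖z‖ < 1) :
    Continuous fun θ : ℝ => f (z * Complex.exp (θ * Complex.I)) := by
  apply hf.comp_continuous (by fun_prop)
  intro θ
  simp [Complex.norm_exp_ofReal_mul_I, hz]

lemma ptbound16 (r : ℝ) (hr0 : 0 ≤ r) (hr : r < 1) : ∃ M : ℝ, 0 ≤ M ∧ ∀ (p : ℝ) (f : ℂ → ℂ), 1 ≤ p →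
    DifferentiableOn ℂ f (ball (0:ℂ) 1) →
    (∀ ρ : ℝ, 0 ≤ ρ → ρ < 1 →
      (1 / (2 * Real.pi)) *
          ∫ θ in (0:ℝ)..(2 * Real.pi),
            ‖f ((ρ : ℂ) * Complex.exp (θ * Complex.I))‖ ^ p ≤ 1) →
    ∀ z ∈ closedBall (0:ℂ) r, ‖f z‖ ≤ M := by
  set ρ := (1 + r) / 2 with hρ
  have hρr : 0 < ρ - r := by rw [hρ]; linarith
  have hρ1 : ρ < 1 := by rw [hρ]; linarith
  have hρ0 : 0 < ρ := by linarith
  refine ⟨ρ / (ρ - r) * 2, by positivity, fun p f hp hf hm z hz => ?_⟩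
  have hzr : ‖z‖ ≤ r := by simpa using hz
  have hpi := Real.pi_pos
  have hc := DiffContOnCl.circleIntegral_sub_inv_smul (R := ρ) (c := 0) (w := z) (f := f)
    (by
      apply DifferentiableOn.diffContOnCl
      apply hf.mono
      rw [closure_ball _ hρ0.ne']
      exact closedBall_subset_ball hρ1) (by simp; linarith)
  have hcont : Continuous fun θ : ℝ => f ((ρ:ℂ) * Complex.exp (θ * Complex.I)) :=
    cont_circ16 hf.continuousOn (by simp [abs_of_pos hρ0, hρ1])
  have hcontp : Continuous fun θ : ℝ => ‖f ((ρ:ℂ) * Complex.exp (θ * Complex.I))‖ ^ p :=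
    hcont.norm.rpow_const (fun _ => Or.inr (by linarith))
  have h1 : ‖∮ w in C(0, ρ), (w - z)⁻¹ • f w‖ ≤ ∫ θ in (0:ℝ)..(2 * Real.pi),
      ρ / (ρ - r) * (1 + ‖f ((ρ:ℂ) * Complex.exp (θ * Complex.I))‖ ^ p) := by
    rw [circleIntegral]
    apply intervalIntegral.norm_integral_le_of_norm_le (by positivity)
    · filter_upwards with θ _
      have hcm : circleMap 0 ρ θ = (ρ:ℂ) * Complex.exp (θ * Complex.I) := by simp [circleMap]
      have hn : ‖circleMap 0 ρ θ‖ = ρ := by simp [abs_of_pos hρ0]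
      simp only [deriv_circleMap, norm_smul, norm_mul, Complex.norm_I, mul_one, hn, norm_inv]
      rw [← hcm]
      have e1 : ρ - r ≤ ‖circleMap 0 ρ θ - z‖ := by
        have := norm_sub_norm_le (circleMap 0 ρ θ) z
        rw [hn] at this
        linarith
      have e2 : ‖f (circleMap 0 ρ θ)‖ ≤ 1 + ‖f (circleMap 0 ρ θ)‖ ^ p := by
        rcases le_total ‖f (circleMap 0 ρ θ)‖ 1 with h | h
        · have : 0 ≤ ‖f (circleMap 0 ρ θ)‖ ^ p := by positivity
          linarith
        · have := Real.self_le_rpow_of_one_le h hp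
          linarith
      rw [← mul_assoc, div_eq_mul_inv]
      gcongr
    · exact (continuous_const.mul (continuous_const.add hcontp)).intervalIntegrable _ _
  rw [hc, intervalIntegral.integral_const_mul, intervalIntegral.integral_add
    (by simp) (hcontp.intervalIntegrable _ _)] at h1
  have h2 := hm ρ hρ0.le hρ1
  rw [one_div, inv_mul_le_iff₀ (by positivity)] at h2
  simp only [smul_eq_mul, norm_mul, Complex.norm_I, intervalIntegral.integral_const] at h1
  simp only [Complex.norm_ofNat, Complex.norm_real, Real.norm_eq_abs, abs_of_pos hpi, mul_one, sub_zero] at h1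
  have h3 : 2 * Real.pi * ‖f z‖ ≤ 2 * Real.pi * (ρ / (ρ - r) * 2) := by
    refine h1.trans ?_
    have : 0 < ρ / (ρ - r) := by positivity
    nlinarith
  exact le_of_mul_le_mul_left h3 (by positivity)

lemma mono_mean16 {G : ℂ → ℂ} (hG : DifferentiableOn ℂ G (ball (0:ℂ) 1))
    (hne : ∀ z ∈ ball (0:ℂ) 1, G z ≠ 0) {ρ ρ' : ℝ} (h0 : 0 ≤ ρ) (h1 : ρ < ρ') (h2 : ρ' < 1) :
    ∫ θ in (0:ℝ)..(2 * Real.pi), ‖G ((ρ : ℂ) * Complex.exp (θ * Complex.I))‖ ≤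
      ∫ θ in (0:ℝ)..(2 * Real.pi), ‖G ((ρ' : ℂ) * Complex.exp (θ * Complex.I))‖ := by
  have hpi := Real.pi_pos
  have hρ' : 0 < ρ' := by linarith
  have hGρ : ∀ z : ℂ, ‖z‖ < 1 → Continuous fun θ : ℝ => G (z * Complex.exp (θ * Complex.I)) :=
    fun z hz => cont_circ16 hG.continuousOn hz
  have hnρ : ‖(ρ:ℂ)‖ < 1 := by simp [abs_of_nonneg h0]; linarith
  have hne' : ∀ θ : ℝ, G ((ρ:ℂ) * Complex.exp (θ * Complex.I)) ≠ 0 := fun θ =>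
    hne _ (by simp [Complex.norm_exp_ofReal_mul_I, abs_of_nonneg h0]; linarith)
  set s : ℝ → ℂ := fun θ => (starRingEnd ℂ) (G ((ρ:ℂ) * Complex.exp (θ * Complex.I))) /
    (‖G ((ρ:ℂ) * Complex.exp (θ * Complex.I))‖ : ℂ) with hs
  have hsc : Continuous s := by
    apply Continuous.div
    · exact Complex.continuous_conj.comp (hGρ _ hnρ)
    · exact Complex.continuous_ofReal.comp (hGρ _ hnρ).norm
    · intro θ; simpa using hne' θ
  have hsn : ∀ θ, ‖s θ‖ = 1 := by
    intro θ
    simp only [hs, norm_div, RCLike.norm_conj, Complex.norm_real, norm_norm]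
    exact div_self (by simpa using hne' θ)
  set φ : ℂ → ℂ := fun z => ∫ θ in (0:ℝ)..(2 * Real.pi),
    G (z * Complex.exp (θ * Complex.I)) * s θ with hφ
  have hφd : DifferentiableOn ℂ φ (ball (0:ℂ) 1) := by
    intro z0 hz0
    apply DifferentiableAt.differentiableWithinAt
    have hz0' : ‖z0‖ < 1 := by simpa using hz0
    obtain ⟨r, hr1, hr2⟩ := exists_between hz0'
    have hdc : ContinuousOn (deriv G) (ball (0:ℂ) 1) := (hG.deriv isOpen_ball).continuousOn
    obtain ⟨M, hM⟩ := (isCompact_closedBall (0:ℂ) r).exists_bound_of_continuousOn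
      (hdc.mono (closedBall_subset_ball hr2))
    refine (intervalIntegral.hasDerivAt_integral_of_dominated_loc_of_deriv_le
      (F' := fun z θ => deriv G (z * Complex.exp (θ * Complex.I)) * Complex.exp (θ * Complex.I) * s θ)
      (s := ball (0:ℂ) r) (bound := fun _ => M) (isOpen_ball.mem_nhds (by simpa using hr1))
      ?_ ?_ ?_ ?_ ?_ ?_).2.differentiableAt
    · filter_upwards [isOpen_ball.mem_nhds hz0] with z hz
      exact ((hGρ z (by simpa using hz)).mul hsc).aestronglyMeasurable
    · exact ((hGρ z0 hz0').mul hsc).intervalIntegrable _ _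
    · refine Continuous.aestronglyMeasurable ?_
      exact ((cont_circ16 hdc hz0').mul (by fun_prop)).mul hsc
    · filter_upwards with θ _ z hz
      rw [norm_mul, norm_mul, hsn, Complex.norm_exp_ofReal_mul_I, mul_one, mul_one]
      apply hM
      have : ‖z‖ < r := by simpa using hz
      simp [Complex.norm_exp_ofReal_mul_I, this.le]
    · simp
    · filter_upwards with θ _ z hz
      have hz' : ‖z‖ < r := by simpa using hz
      have hd : HasDerivAt G (deriv G (z * Complex.exp (θ * Complex.I)))
          (z * Complex.exp (θ * Complex.I)) :=
        (hG.differentiableAt (isOpen_ball.mem_nhds (by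
          simp [Complex.norm_exp_ofReal_mul_I]; linarith))).hasDerivAt
      have hd2 : HasDerivAt (fun z : ℂ => z * Complex.exp (θ * Complex.I))
          (Complex.exp (θ * Complex.I)) z := by
        simpa using (hasDerivAt_id z).mul_const (Complex.exp (θ * Complex.I))
      exact (hd.comp z hd2).mul_const _
  have hφρ : φ ρ = ((∫ θ in (0:ℝ)..(2 * Real.pi),
      ‖G ((ρ : ℂ) * Complex.exp (θ * Complex.I))‖ : ℝ) : ℂ) := by
    rw [← intervalIntegral.integral_ofReal]
    apply intervalIntegral.integral_congr
    intro θ _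
    simp only [hs]
    rw [mul_div_assoc', Complex.mul_conj, Complex.normSq_eq_norm_sq]
    have := hne' θ
    have h' : (‖G ((ρ : ℂ) * Complex.exp (θ * Complex.I))‖ : ℂ) ≠ 0 := by simpa using this
    push_cast
    field_simp
  have key : ‖φ ρ‖ ≤ ∫ θ in (0:ℝ)..(2 * Real.pi), ‖G ((ρ' : ℂ) * Complex.exp (θ * Complex.I))‖ := by
    apply Complex.norm_le_of_forall_mem_frontier_norm_le (U := ball (0:ℂ) ρ') isBounded_ball
    · apply DifferentiableOn.diffContOnCl
      apply hφd.mono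
      rw [closure_ball _ hρ'.ne']
      exact closedBall_subset_ball h2
    · intro w hw
      rw [frontier_ball _ hρ'.ne', mem_sphere_zero_iff_norm] at hw
      have hw1 : ‖w‖ < 1 := by linarith
      have hwe : w = ρ' * Complex.exp (w.arg * Complex.I) := by
        rw [← hw]; exact (Complex.norm_mul_exp_arg_mul_I w).symm
      set P : ℝ → ℝ := fun θ => ‖G ((ρ' : ℂ) * Complex.exp (θ * Complex.I))‖ with hP
      have hper : Function.Periodic P (2 * Real.pi) := by
        intro θ
        simp only [hP]
        congr 3
        push_cast
        rw [add_mul, Complex.exp_add, Complex.exp_two_pi_mul_I, mul_one]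
      have e1 : ∀ θ : ℝ, ‖G (w * Complex.exp (θ * Complex.I)) * s θ‖ = P (θ + w.arg) := by
        intro θ
        rw [norm_mul, hsn, mul_one]
        simp only [hP]
        congr 2
        conv_lhs => rw [hwe]
        push_cast
        rw [add_mul, Complex.exp_add]
        ring
      calc ‖φ w‖ ≤ ∫ θ in (0:ℝ)..(2 * Real.pi), ‖G (w * Complex.exp (θ * Complex.I)) * s θ‖ :=
            intervalIntegral.norm_integral_le_integral_norm (by positivity)
        _ = ∫ θ in (0:ℝ)..(2 * Real.pi), P (θ + w.arg) := by simp_rw [e1]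
        _ = ∫ θ in (w.arg)..(w.arg + 2 * Real.pi), P θ := by
            rw [intervalIntegral.integral_comp_add_right]
            congr 1 <;> ring
        _ = ∫ θ in (0:ℝ)..(0 + 2 * Real.pi), P θ := hper.intervalIntegral_add_eq _ _
        _ = _ := by rw [zero_add]
    · rw [closure_ball _ hρ'.ne']
      simp [abs_of_nonneg h0, h1.le]
  rw [hφρ, Complex.norm_real] at key
  exact (le_abs_self _).trans key

lemma mean_bdry16 {F L : ℂ → ℂ} (hF : ContinuousOn F (closedBall (0:ℂ) 1))
    (hL : DifferentiableOn ℂ L (ball (0:ℂ) 1))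
    (hFL : ∀ z ∈ ball (0:ℂ) 1, F z = Complex.exp (L z)) {q : ℝ} (hq : 1 ≤ q) {A : ℝ}
    (hA : ∫ θ in (0:ℝ)..(2 * Real.pi), ‖F (Complex.exp (θ * Complex.I))‖ ^ q ≤ A)
    {ρ : ℝ} (h0 : 0 ≤ ρ) (h1 : ρ < 1) :
    ∫ θ in (0:ℝ)..(2 * Real.pi), ‖F ((ρ : ℂ) * Complex.exp (θ * Complex.I))‖ ^ q ≤ A := by
  set m : ℝ → ℝ := fun t => ∫ θ in (0:ℝ)..(2 * Real.pi),
    ‖F (((max 0 (min t 1) : ℝ) : ℂ) * Complex.exp (θ * Complex.I))‖ ^ q with hm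
  have hmc : Continuous m := by
    apply intervalIntegral.continuous_parametric_intervalIntegral_of_continuous'
    refine Continuous.rpow_const (Continuous.norm ?_) (fun _ => Or.inr (by linarith))
    refine hF.comp_continuous (f := fun x : ℝ × ℝ => ((max 0 (min x.1 1) : ℝ) : ℂ) * Complex.exp (x.2 * Complex.I)) (by fun_prop) ?_
    rintro ⟨t, θ⟩
    rw [mem_closedBall_zero_iff, norm_mul, Complex.norm_exp_ofReal_mul_I, mul_one, Complex.norm_real,
      Real.norm_eq_abs, abs_of_nonneg (le_max_left _ _)]
    exact max_le zero_le_one (min_le_right _ _)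
  have hmeq : ∀ t, 0 ≤ t → t ≤ 1 → m t = ∫ θ in (0:ℝ)..(2 * Real.pi),
      ‖F ((t : ℂ) * Complex.exp (θ * Complex.I))‖ ^ q := by
    intro t ht ht1
    simp only [hm, min_eq_left ht1, max_eq_right ht]
  have hm1 : m 1 ≤ A := by
    rw [hmeq 1 zero_le_one le_rfl]; simpa using hA
  set G : ℂ → ℂ := fun z => Complex.exp (q * L z) with hG
  have hGF : ∀ z ∈ ball (0:ℂ) 1, ‖F z‖ ^ q = ‖G z‖ := by
    intro z hz
    rw [hFL z hz, hG, Complex.norm_exp, Complex.norm_exp, ← Real.exp_mul]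
    simp [mul_comm]
  have hGd : DifferentiableOn ℂ G (ball (0:ℂ) 1) := (hL.const_mul _).cexp
  have hmG : ∀ t, 0 ≤ t → t < 1 → m t = ∫ θ in (0:ℝ)..(2 * Real.pi),
      ‖G ((t : ℂ) * Complex.exp (θ * Complex.I))‖ := by
    intro t ht ht1
    rw [hmeq t ht ht1.le]
    apply intervalIntegral.integral_congr
    intro θ _
    apply hGF
    simp [Complex.norm_exp_ofReal_mul_I, abs_of_nonneg ht, ht1]
  rw [← hmeq ρ h0 h1.le]
  refine le_trans ?_ hm1
  have ht : Filter.Tendsto m (nhdsWithin 1 (Set.Iio 1)) (nhds (m 1)) :=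
    hmc.continuousAt.tendsto.mono_left nhdsWithin_le_nhds
  apply ge_of_tendsto ht
  filter_upwards [Ioo_mem_nhdsLT h1] with t ht
  rw [hmG ρ h0 h1, hmG t (h0.trans ht.1.le) ht.2]
  exact mono_mean16 hGd (fun z _ => Complex.exp_ne_zero _) h0 ht.1 ht.2

lemma exists_log16 {F : ℂ → ℂ} (hF : DifferentiableOn ℂ F (ball (0:ℂ) 1))
    (hne : ∀ z ∈ ball (0:ℂ) 1, F z ≠ 0) : ∃ L : ℂ → ℂ, DifferentiableOn ℂ L (ball (0:ℂ) 1) ∧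
      ∀ z ∈ ball (0:ℂ) 1, F z = Complex.exp (L z) := by
  have h0 : (0:ℂ) ∈ ball (0:ℂ) 1 := by simp
  have hd : DifferentiableOn ℂ (fun z => deriv F z / F z) (ball (0:ℂ) 1) :=
    (hF.deriv isOpen_ball).div hF hne
  obtain ⟨L, hL0, hL⟩ := hd.isExactOn_ball.with_val_at 0 (Complex.log (F 0))
  refine ⟨L, fun z hz => (hL z hz).differentiableAt.differentiableWithinAt, ?_⟩
  set H : ℂ → ℂ := fun z => F z * Complex.exp (-L z) with hH
  have hHd : ∀ z ∈ ball (0:ℂ) 1, HasDerivAt H 0 z := by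
    intro z hz
    have e1 := (hF.differentiableAt (isOpen_ball.mem_nhds hz)).hasDerivAt
    have e2 := (hL z hz).neg.cexp
    have h3 : F z * (deriv F z / F z) = deriv F z := mul_div_cancel₀ _ (hne z hz)
    refine (e1.mul e2).congr_deriv ?_
    simp only [Pi.neg_apply]
    linear_combination (-Complex.exp (-L z)) * h3
  intro z hz
  have hc : H z = H 0 := by
    apply isOpen_ball.is_const_of_deriv_eq_zero (convex_ball (0:ℂ) 1).isPreconnected
      (fun w hw => (hHd w hw).differentiableAt.differentiableWithinAt)
      (fun w hw => (hHd w hw).deriv) hz h0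
  have : H 0 = 1 := by
    simp only [hH, hL0, Complex.exp_neg, Complex.exp_log (hne 0 h0)]
    exact mul_inv_cancel₀ (hne 0 h0)
  rw [this] at hc
  simp only [hH, Complex.exp_neg] at hc
  exact (mul_inv_eq_one₀ (Complex.exp_ne_zero _)).mp hc

lemma factor16 {R : ℝ} (hR : 1 < R) (S : Finset ℂ) : ∀ F : ℂ → ℂ, DifferentiableOn ℂ F (ball (0:ℂ) R) →
    {z | z ∈ ball (0:ℂ) 1 ∧ F z = 0} = (S : Set ℂ) →
    ∃ F' B : ℂ → ℂ, DifferentiableOn ℂ F' (ball (0:ℂ) R) ∧ DifferentiableOn ℂ B (ball (0:ℂ) 1) ∧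
      (∀ z ∈ ball (0:ℂ) 1, F' z ≠ 0) ∧ (∀ z ∈ ball (0:ℂ) 1, ‖B z‖ ≤ 1) ∧
      (∀ z ∈ ball (0:ℂ) 1, F z = F' z * B z) ∧ ∀ z ∈ sphere (0:ℂ) 1, ‖F' z‖ = ‖F z‖ := by
  induction S using Finset.induction_on with
  | empty =>
    intro F hF hS
    refine ⟨F, 1, hF, by fun_prop, fun z hz h => ?_, by simp, by simp, by simp⟩
    have : z ∈ {z | z ∈ ball (0:ℂ) 1 ∧ F z = 0} := ⟨hz, h⟩
    rw [hS] at this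
    simp at this
  | insert a S haS ih =>
    intro F hF hS
    have haF : a ∈ ball (0:ℂ) 1 ∧ F a = 0 := by
      have : a ∈ {z | z ∈ ball (0:ℂ) 1 ∧ F z = 0} := by rw [hS]; simp
      exact this
    have ha1 : ‖a‖ < 1 := by simpa using haF.1
    have haR : a ∈ ball (0:ℂ) R := by simp; linarith
    have han : AnalyticAt ℂ F a := hF.analyticAt (isOpen_ball.mem_nhds haR)
    have hnz : ¬ ∀ᶠ z in nhds a, F z = 0 := by
      intro h
      have hmem : {z | z ∈ ball (0:ℂ) 1 ∧ F z = 0} ∈ nhds a := by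
        filter_upwards [h, isOpen_ball.mem_nhds haF.1] with z h1 h2
        exact ⟨h2, h1⟩
      rw [hS] at hmem
      exact (infinite_of_mem_nhds a hmem) (Finset.finite_toSet _)
    obtain ⟨m, g, hg, hga, hgF⟩ := han.exists_eventuallyEq_pow_smul_nonzero_iff.mpr hnz
    set F1 : ℂ → ℂ := fun z => if z = a then g a else F z / (z - a) ^ m with hF1
    have hF1d : DifferentiableOn ℂ F1 (ball (0:ℂ) R) := by
      intro z hz
      apply DifferentiableAt.differentiableWithinAt
      by_cases hza : z = a
      · subst hza
        apply hg.differentiableAt.congr_of_eventuallyEq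
        filter_upwards [hgF] with w hw
        by_cases hwz : w = z
        · simp [hF1, hwz]
        · have : w - z ≠ 0 := sub_ne_zero.mpr hwz
          simp only [hF1, hwz, if_false, hw, smul_eq_mul]
          field_simp
      · have h1 : DifferentiableAt ℂ (fun w => F w / (w - a) ^ m) z := by
          apply DifferentiableAt.div (hF.differentiableAt (isOpen_ball.mem_nhds hz)) (by fun_prop)
          exact pow_ne_zero _ (sub_ne_zero.mpr hza)
        apply h1.congr_of_eventuallyEq
        filter_upwards [isOpen_ne.mem_nhds hza] with w hw
        simp [hF1, hw]
    have hFF1 : ∀ z, F z = (z - a) ^ m * F1 z := by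
      intro z
      by_cases hza : z = a
      · subst hza
        simpa [hF1] using hgF.self_of_nhds
      · have : z - a ≠ 0 := sub_ne_zero.mpr hza
        simp only [hF1, hza, if_false]
        field_simp
    set F2 : ℂ → ℂ := fun z => F1 z * (1 - (starRingEnd ℂ) a * z) ^ m with hF2
    have hF2d : DifferentiableOn ℂ F2 (ball (0:ℂ) R) := hF1d.mul (by fun_prop)
    have hF2z : ∀ z ∈ ball (0:ℂ) 1, (F2 z = 0 ↔ z ≠ a ∧ F z = 0) := by
      intro z hz
      have hd := den_ne16 ha1.le (z := z) (by simpa using hz)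
      have : F2 z = 0 ↔ F1 z = 0 := by simp [hF2, hd]
      rw [this]
      by_cases hza : z = a
      · simp [hza, hF1, hga]
      · have : z - a ≠ 0 := sub_ne_zero.mpr hza
        rw [hFF1 z]
        simp [this, hza]
    obtain ⟨F', B, hF', hB, hF'n, hBn, hFB, hsp⟩ := ih F2 hF2d (by
      ext z
      constructor
      · rintro ⟨hz, hz2⟩
        have h1 := (hF2z z hz).mp hz2
        have : z ∈ {z | z ∈ ball (0:ℂ) 1 ∧ F z = 0} := ⟨hz, h1.2⟩
        rw [hS] at this
        simpa [h1.1] using this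
      · intro hz
        have : z ∈ {z | z ∈ ball (0:ℂ) 1 ∧ F z = 0} := by
          rw [hS]; simpa using Or.inr hz
        refine ⟨this.1, (hF2z z this.1).mpr ⟨?_, this.2⟩⟩
        rintro rfl
        exact haS hz)
    refine ⟨F', fun z => B z * ((z - a) / (1 - (starRingEnd ℂ) a * z)) ^ m, hF', ?_, hF'n, ?_, ?_, ?_⟩
    · apply hB.mul
      apply DifferentiableOn.pow
      apply DifferentiableOn.div (by fun_prop) (by fun_prop)
      intro z hz
      exact den_ne16 ha1.le (by simpa using hz)
    · intro z hz
      rw [norm_mul, norm_pow, norm_div]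
      have hz' : ‖z‖ < 1 := by simpa using hz
      apply mul_le_one₀ (hBn z hz) (by positivity)
      exact pow_le_one₀ (by positivity)
        (div_le_one_of_le₀ (norm_le_den16 ha1.le hz'.le) (norm_nonneg _))
    · intro z hz
      have hd := den_ne16 ha1.le (z := z) (by simpa using hz)
      rw [← mul_assoc, ← hFB z hz, hFF1 z, hF2, div_pow, mul_div_assoc', eq_div_iff (pow_ne_zero _ hd)]
      ring
    · intro z hz
      rw [hsp z hz, hF2, hFF1 z, norm_mul, norm_mul, norm_pow, norm_pow,
        norm_eq_den16 (a := a) (by simpa using hz), mul_comm]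

lemma finite_zeros16 {R : ℝ} (hR : 1 < R) {F : ℂ → ℂ} (hF : DifferentiableOn ℂ F (ball (0:ℂ) R))
    (hnz : ∃ z ∈ ball (0:ℂ) R, F z ≠ 0) : {z | z ∈ ball (0:ℂ) 1 ∧ F z = 0}.Finite := by
  by_contra hinf
  have hsub : {z | z ∈ ball (0:ℂ) 1 ∧ F z = 0} ⊆ closedBall (0:ℂ) 1 :=
    fun z hz => ball_subset_closedBall hz.1
  obtain ⟨x, hx, hacc⟩ := Set.Infinite.exists_accPt_of_subset_isCompact hinf
    (isCompact_closedBall (0:ℂ) 1) hsub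
  obtain ⟨z, hz, hz0⟩ := hnz
  apply hz0
  have han : AnalyticOnNhd ℂ F (ball (0:ℂ) R) := hF.analyticOnNhd isOpen_ball
  refine han.eqOn_zero_of_preconnected_of_frequently_eq_zero (convex_ball (0:ℂ) R).isPreconnected
    (closedBall_subset_ball hR hx) ?_ hz
  exact (accPt_iff_frequently_nhdsNE.mp hacc).mono (fun w hw => hw.2)

lemma key16 (n : ℕ) (l : Fin n → ℂ) {p q : ℝ} (hq : 1 ≤ q) {k : ℕ} (hk : 0 < k) (hp : p = k * q)
    {f : ℂ → ℂ} (hf : DifferentiableOn ℂ f (ball (0:ℂ) 1))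
    (hm : ∀ ρ : ℝ, 0 ≤ ρ → ρ < 1 →
      (1 / (2 * Real.pi)) *
          ∫ θ in (0:ℝ)..(2 * Real.pi),
            ‖f ((ρ : ℂ) * Complex.exp (θ * Complex.I))‖ ^ q ≤ 1)
    {r : ℝ} (hr0 : 0 < r) (hr1 : r < 1) :
    ∃ h : ℂ → ℂ, DifferentiableOn ℂ h (ball (0:ℂ) 1) ∧
      (∀ ρ : ℝ, 0 ≤ ρ → ρ < 1 →
      (1 / (2 * Real.pi)) *
          ∫ θ in (0:ℝ)..(2 * Real.pi),
            ‖h ((ρ : ℂ) * Complex.exp (θ * Complex.I))‖ ^ p ≤ 1) ∧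
      ∀ C, Adm16 n l h C → Adm16 n l (fun z => f (r * z)) (C ^ k) := by
  have hpi := Real.pi_pos
  have hk' : (k:ℂ) ≠ 0 := by exact_mod_cast hk.ne'
  have hp0 : 0 < p := by rw [hp]; positivity
  set R := 1 / r with hR
  have hR1 : 1 < R := by rw [hR]; exact (one_lt_div hr0).mpr hr1
  set F : ℂ → ℂ := fun z => f (r * z) with hF
  have hFd : DifferentiableOn ℂ F (ball (0:ℂ) R) := by
    apply hf.comp (by fun_prop)
    intro z hz
    have hz' : ‖z‖ < 1 / r := by simpa [hR] using hz
    rw [lt_div_iff₀ hr0] at hz'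
    simp [abs_of_pos hr0]
    linarith
  by_cases hz : ∃ z ∈ ball (0:ℂ) R, F z ≠ 0
  · have hfin := finite_zeros16 hR1 hFd hz
    obtain ⟨F', B, hF'd, hBd, hF'n, hBn, hFB, hsp⟩ := factor16 hR1 hfin.toFinset F hFd (by simp)
    have hsub : closedBall (0:ℂ) 1 ⊆ ball (0:ℂ) R := closedBall_subset_ball hR1
    obtain ⟨L, hLd, hL⟩ := exists_log16 (hF'd.mono (ball_subset_closedBall.trans hsub)) hF'n
    refine ⟨fun z => Complex.exp (L z / k), (hLd.div_const _).cexp, ?_, ?_⟩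
    · intro ρ h0 h1
      rw [one_div, inv_mul_le_iff₀ (by positivity), mul_one]
      have hA : ∫ θ in (0:ℝ)..(2 * Real.pi), ‖F' (Complex.exp (θ * Complex.I))‖ ^ q ≤ 2 * Real.pi := by
        have h2 := hm r hr0.le hr1
        rw [one_div, inv_mul_le_iff₀ (by positivity), mul_one] at h2
        refine le_trans (le_of_eq ?_) h2
        apply intervalIntegral.integral_congr
        intro θ _
        simp only
        rw [hsp _ (by simp [Complex.norm_exp_ofReal_mul_I])]
      have := mean_bdry16 (hF'd.continuousOn.mono hsub) hLd hL hq hA h0 h1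
      refine le_trans (le_of_eq ?_) this
      apply intervalIntegral.integral_congr
      intro θ _
      simp only
      rw [hL _ (by simp [Complex.norm_exp_ofReal_mul_I, abs_of_nonneg h0, h1]), Complex.norm_exp,
        Complex.norm_exp, ← Real.exp_mul, ← Real.exp_mul, hp, Complex.div_natCast_re]
      have : (k:ℝ) ≠ 0 := by exact_mod_cast hk.ne'
      field_simp
    · rintro C ⟨hC, g, u, hg, hgC, hu, hgu⟩
      set h : ℂ → ℂ := fun z => Complex.exp (L z / k) with hh
      have hhd : DifferentiableOn ℂ h (ball (0:ℂ) 1) := (hLd.div_const _).cexp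
      refine ⟨by positivity, fun z => B z * g z ^ k, fun z => B z * (u z *
        ∑ i ∈ Finset.range k, g z ^ i * h z ^ (k - 1 - i)), hBd.mul (hg.pow _), ?_, ?_, ?_⟩
      · intro z hz
        rw [norm_mul, norm_pow]
        calc _ ≤ 1 * C ^ k := by
              gcongr
              · exact hBn z hz
              · exact hgC z hz
          _ = _ := one_mul _
      · refine hBd.mul (hu.mul ?_)
        exact DifferentiableOn.fun_sum fun i _ => (hg.pow _).mul (hhd.pow _)
      · intro z hz
        have e1 : h z ^ k = F' z := by
          rw [hL z hz, hh]
          simp only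
          rw [← Complex.exp_nat_mul]
          congr 1
          field_simp
        have e2 := (Commute.all (g z) (h z)).mul_geom_sum₂ k
        have e3 := hgu z hz
        rw [hFB z hz, ← e1]
        simp only [hh] at e2 e3 ⊢
        linear_combination (-B z) * e2 + B z * (∑ i ∈ Finset.range k, g z ^ i * Complex.exp (L z / k) ^ (k - 1 - i)) * e3
  · push Not at hz
    refine ⟨0, by fun_prop, ?_, ?_⟩
    · intro ρ _ _
      simp [Real.zero_rpow hp0.ne']
    · rintro C ⟨hC, -⟩
      refine ⟨by positivity, 0, 0, by fun_prop, ?_, by fun_prop, ?_⟩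
      · intro z _; simp; positivity
      · intro z hz'
        have := hz z (ball_subset_ball hR1.le hz')
        simp [this]

lemma adm_bdd16 (n : ℕ) (l : Fin n → ℂ) (f : ℂ → ℂ) : BddBelow {C | Adm16 n l f C} :=
  ⟨0, fun _ h => h.1⟩

/-- if `p/q` is a positive integer then
`c(σ, H^p, H^∞) ≥ c(σ, H^q, H^∞)^{q/p}`. -/
theorem stmt_16 (n : ℕ) (l : Fin n → ℂ) (hl : ∀ j, ‖l j‖ < 1)
    (p q : ℝ) (hq : 1 ≤ q) (hp : 1 ≤ p)
    (hpq : ∃ k : ℕ, 0 < k ∧ p = k * q) :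
    (cHp16 q n l) ^ (q / p) ≤ cHp16 p n l := by
  obtain ⟨k, hk, hpk⟩ := hpq
  obtain ⟨r0, ⟨hr00, hr01⟩, hlr⟩ : ∃ r : ℝ, (0 < r ∧ r < 1) ∧ ∀ j, ‖l j‖ < r := by
    have h1 : ∀ᶠ r in nhdsWithin (1:ℝ) (Set.Iio 1), 0 < r ∧ r < 1 := Ioo_mem_nhdsLT one_pos
    have h2 : ∀ᶠ r in nhdsWithin (1:ℝ) (Set.Iio 1), ∀ j, ‖l j‖ < r := by
      rw [Filter.eventually_all]
      intro j
      filter_upwards [Ioo_mem_nhdsLT (hl j)] with r hr using hr.1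
    exact (h1.and h2).exists
  obtain ⟨K, hK, hint⟩ := interp16 n l r0 hr01 hlr
  obtain ⟨M, hM, hpt⟩ := ptbound16 r0 hr00.le hr01
  set c := cHp16 p n l with hc
  -- every member of the set for `p` is at most `c`
  have hle : ∀ h : ℂ → ℂ, DifferentiableOn ℂ h (ball (0:ℂ) 1) →
      (∀ ρ : ℝ, 0 ≤ ρ → ρ < 1 →
      (1 / (2 * Real.pi)) *
          ∫ θ in (0:ℝ)..(2 * Real.pi),
            ‖h ((ρ : ℂ) * Complex.exp (θ * Complex.I))‖ ^ p ≤ 1) →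
      sInf {C | Adm16 n l h C} ≤ c := by
    intro h hh hm
    apply le_csSup
    · refine ⟨K * M, ?_⟩
      rintro t ⟨f, hf, hfm, rfl⟩
      exact csInf_le (adm_bdd16 n l f) (hint f M hf hM (hpt p f hp hf hfm))
    · exact ⟨h, hh, hm, rfl⟩
  have hc0 : 0 ≤ c := by
    apply Real.sSup_nonneg
    rintro t ⟨f, hf, hfm, rfl⟩
    exact Real.sInf_nonneg (fun C hC => hC.1)
  have hcq0 : 0 ≤ cHp16 q n l := by
    apply Real.sSup_nonneg
    rintro t ⟨f, hf, hfm, rfl⟩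
    exact Real.sInf_nonneg (fun C hC => hC.1)
  have main : cHp16 q n l ≤ c ^ k := by
    apply Real.sSup_le _ (by positivity)
    rintro t ⟨f, hf, hfm, rfl⟩
    change sInf {C | Adm16 n l f C} ≤ c ^ k
    have hε : ∀ ε : ℝ, 0 < ε → sInf {C | Adm16 n l f C} ≤ (c + ε) ^ k + K * ε := by
      intro ε hε
      have huc : UniformContinuousOn f (closedBall (0:ℂ) r0) :=
        (isCompact_closedBall (0:ℂ) r0).uniformContinuousOn_of_continuous
          (hf.continuousOn.mono (closedBall_subset_ball hr01))
      obtain ⟨δ, hδ, hu⟩ := Metric.uniformContinuousOn_iff.mp huc ε hε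
      obtain ⟨r, hr1, hr2⟩ := exists_between (show max 0 (1 - δ) < 1 from max_lt one_pos (by linarith))
      have hr0 : 0 < r := (le_max_left _ _).trans_lt hr1
      have hrδ : 1 - r < δ := by have := (le_max_right _ _).trans_lt hr1; linarith
      obtain ⟨h, hh, hhm, hadm⟩ := key16 n l hq hk hpk hf hfm hr0 hr2
      have hfr : DifferentiableOn ℂ (fun z : ℂ => f (r * z)) (ball (0:ℂ) 1) := by
        apply hf.comp (by fun_prop)
        intro z hz
        have hz' : ‖z‖ < 1 := by simpa using hz
        simp [abs_of_pos hr0]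
        nlinarith [norm_nonneg z]
      obtain ⟨-, g1, u1, hg1, hg1b, hu1, hgu1⟩ := hint (fun z => f z - f (r * z)) ε (hf.sub hfr) hε.le (by
        intro z hz
        have hz' : ‖z‖ ≤ r0 := by simpa using hz
        rw [← dist_eq_norm]
        refine (hu z hz (r * z) ?_ ?_).le
        · simp [abs_of_pos hr0]
          nlinarith [norm_nonneg z]
        · rw [dist_eq_norm, show z - r * z = ((1 - r : ℝ) : ℂ) * z by push_cast; ring, norm_mul,
            Complex.norm_real, Real.norm_eq_abs, abs_of_pos (by linarith)]
          nlinarith [norm_nonneg z])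
      have hne : {C | Adm16 n l h C}.Nonempty := ⟨_, hint h M hh hM (hpt p h hp hh hhm)⟩
      obtain ⟨C, hC, hCc⟩ := exists_lt_of_csInf_lt hne
        (show sInf {C | Adm16 n l h C} < c + ε by linarith [hle h hh hhm])
      have hC0 : 0 ≤ C := hC.1
      obtain ⟨-, g2, u2, hg2, hg2b, hu2, hgu2⟩ := hadm C hC
      have : Adm16 n l f (C ^ k + K * ε) := by
        refine ⟨by positivity, fun z => g2 z + g1 z, fun z => u2 z + u1 z, hg2.add hg1, ?_, hu2.add hu1, ?_⟩
        · intro z hz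
          exact (norm_add_le _ _).trans (add_le_add (hg2b z hz) (hg1b z hz))
        · intro z hz
          have e1 := hgu1 z hz
          have e2 := hgu2 z hz
          simp only at e1 e2 ⊢
          linear_combination e1 + e2
      refine (csInf_le (adm_bdd16 n l f) this).trans ?_
      gcongr
    have hcont : Continuous fun ε : ℝ => (c + ε) ^ k + K * ε := by fun_prop
    have ht : Filter.Tendsto (fun ε : ℝ => (c + ε) ^ k + K * ε) (nhdsWithin 0 (Set.Ioi 0))
        (nhds (c ^ k)) := by
      have := hcont.tendsto 0
      simp only [add_zero, mul_zero] at this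
      exact this.mono_left nhdsWithin_le_nhds
    apply ge_of_tendsto ht
    filter_upwards [self_mem_nhdsWithin] with ε hε' using hε ε hε'
  have hqp : q / p = (k:ℝ)⁻¹ := by
    rw [hpk]
    have : (k:ℝ) ≠ 0 := by exact_mod_cast hk.ne'
    field_simp
  rw [hqp]
  calc _ ≤ (c ^ k) ^ ((k:ℝ)⁻¹) := Real.rpow_le_rpow hcq0 main (by positivity)
    _ = c := Real.pow_rpow_inv_natCast hc0 hk.ne'
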